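/- (Doob's Convergence Theorem, game-theoretic version.) Let X be a finite non-empty set with an imprecise probability tree, and let M be a supermartingale. If M(s) is real for some situation s ∈ X*, then M converges to a real number strictly almost surely within Γ(s); that is, there exists an s-test supermartingale T (a non-negative supermartingale with T(s) = 1) such that lim_{n→∞} T(ω^n) = +∞ for every ω ∈ Γ(s) for which the sequence M(ω^n) does not converge to a real number. -/

import Mathlib

open Filter Topology

/-- A function to the extended reals is bounded below by some real number. -/
def BddBelowF {Y : Type*} (f : Y → EReal) : Prop :=
  ∃ M : ℝ, ∀ y, (M : EReal) ≤ f y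

/-- An upper expectation on the bounded-below extended-real functions on `Y`:
axioms E1 (constants), E2 (subadditivity), E3 (positive/`+∞` homogeneity on
non-negative functions) and E4 (monotonicity). -/
structure IsUpperExpectation {Y : Type*} (E : (Y → EReal) → EReal) : Prop where
  const : ∀ c : ℝ, E (fun _ => (c : EReal)) = (c : EReal)
  subadd : ∀ f g : Y → EReal, BddBelowF f → BddBelowF g →
    E (fun y => f y + g y) ≤ E f + E g
  homog : ∀ lam : EReal, 0 < lam → ∀ f : Y → EReal, BddBelowF f → (∀ y, 0 ≤ f y) →
    E (fun y => lam * f y) = lam * E f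
  mono : ∀ f g : Y → EReal, BddBelowF f → BddBelowF g → (∀ y, f y ≤ g y) → E f ≤ E g

/-- The initial segment `ω^n = (ω_1, …, ω_n)` of a path `ω ∈ X^ℕ`. -/
def seg {X : Type*} (ω : ℕ → X) (n : ℕ) : List X :=
  List.ofFn (fun i : Fin n => ω i)

/-- The cylinder event `Γ(s)` of all paths going through the situation `s`. -/
def cyl {X : Type*} (s : List X) : Set (ℕ → X) :=
  {ω | seg ω s.length = s}

/-- A global variable is `n`-measurable if it only depends on the first `n` states. -/
def NMeas {X α : Type*} (n : ℕ) (f : (ℕ → X) → α) : Prop :=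
  ∀ ω ω' : ℕ → X, seg ω n = seg ω' n → f ω = f ω'

/-- A supermartingale for an imprecise probability tree `Q`: a bounded-below
extended-real process `M` on situations such that `Q_s(M(s·)) ≤ M(s)` everywhere. -/
def IsSupermartingale {X : Type*} (Q : List X → (X → EReal) → EReal)
    (M : List X → EReal) : Prop :=
  (∃ B : ℝ, ∀ s, (B : EReal) ≤ M s) ∧ ∀ s, Q s (fun x => M (s ++ [x])) ≤ M s

/-- The game-theoretic upper expectation `Ē_V(f | s)`. -/
noncomputable def gUE {X : Type*} (Q : List X → (X → EReal) → EReal)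
    (f : (ℕ → X) → EReal) (s : List X) : EReal :=
  sInf { y | ∃ M : List X → EReal, IsSupermartingale Q M ∧
    (∀ ω ∈ cyl s, f ω ≤ Filter.liminf (fun n => M (seg ω n)) Filter.atTop) ∧ M s = y }

open scoped ENNReal

/-- The restriction of `E` to `[0, ∞]`-valued functions. -/
noncomputable def nonnegExp {Y : Type*} (E : (Y → EReal) → EReal) (f : Y → ℝ≥0∞) : ℝ≥0∞ :=
  (E fun y => (f y : EReal)).toENNReal

lemma bddBelowF_coe_ennreal {Y : Type*} (f : Y → ℝ≥0∞) : BddBelowF fun y => (f y : EReal) :=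
  ⟨0, fun y => EReal.coe_ennreal_nonneg (f y)⟩

namespace IsUpperExpectation

variable {Y : Type*} {E : (Y → EReal) → EReal}

lemma coe_nonnegExp (hE : IsUpperExpectation E) (f : Y → ℝ≥0∞) :
    (nonnegExp E f : EReal) = E fun y => (f y : EReal) := by
  refine EReal.coe_toENNReal ?_
  have h0 := hE.const 0
  rw [← EReal.coe_zero, ← h0]
  exact hE.mono _ _ ⟨0, fun _ => le_rfl⟩ (bddBelowF_coe_ennreal f) fun y =>
    EReal.coe_ennreal_nonneg (f y)

lemma nonnegExp_mono (hE : IsUpperExpectation E) {f g : Y → ℝ≥0∞} (h : f ≤ g) :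
    nonnegExp E f ≤ nonnegExp E g :=
  EReal.toENNReal_le_toENNReal <| hE.mono _ _ (bddBelowF_coe_ennreal f) (bddBelowF_coe_ennreal g)
    fun y => by exact_mod_cast h y

lemma nonnegExp_add_le (hE : IsUpperExpectation E) (f g : Y → ℝ≥0∞) :
    nonnegExp E (fun y => f y + g y) ≤ nonnegExp E f + nonnegExp E g := by
  rw [← EReal.coe_ennreal_le_coe_ennreal_iff, EReal.coe_ennreal_add]
  simp only [hE.coe_nonnegExp, EReal.coe_ennreal_add]
  exact hE.subadd _ _ (bddBelowF_coe_ennreal f) (bddBelowF_coe_ennreal g)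

lemma nonnegExp_const (hE : IsUpperExpectation E) {c : ℝ≥0∞} (hc : c ≠ ∞) :
    nonnegExp E (fun _ => c) = c := by
  lift c to NNReal using hc
  rw [← EReal.coe_ennreal_eq_coe_ennreal_iff, hE.coe_nonnegExp]
  exact hE.const c

lemma nonnegExp_const_mul (hE : IsUpperExpectation E) (c : ℝ≥0∞) (f : Y → ℝ≥0∞) :
    nonnegExp E (fun y => c * f y) = c * nonnegExp E f := by
  rcases eq_or_ne c 0 with rfl | hc
  · simpa using hE.nonnegExp_const ENNReal.zero_ne_top
  · rw [← EReal.coe_ennreal_eq_coe_ennreal_iff, EReal.coe_ennreal_mul]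
    simp only [hE.coe_nonnegExp, EReal.coe_ennreal_mul]
    exact hE.homog c (by simpa [pos_iff_ne_zero] using hc) _ (bddBelowF_coe_ennreal f)
      fun y => EReal.coe_ennreal_nonneg (f y)

lemma nonnegExp_sum_le (hE : IsUpperExpectation E) (f : ℕ → Y → ℝ≥0∞) (n : ℕ) :
    nonnegExp E (fun y => ∑ i ∈ Finset.range n, f i y) ≤
      ∑ i ∈ Finset.range n, nonnegExp E (f i) := by
  induction n with
  | zero => simpa using (hE.nonnegExp_const ENNReal.zero_ne_top).le
  | succ n ih =>
    simp only [Finset.sum_range_succ]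
    exact (hE.nonnegExp_add_le _ _).trans (by gcongr)

/-- On a finite set, upper expectations are countably subadditive on `[0, ∞]`-valued functions. -/
lemma nonnegExp_tsum_le [Finite Y] (hE : IsUpperExpectation E) (f : ℕ → Y → ℝ≥0∞) :
    nonnegExp E (fun y => ∑' i, f i y) ≤ ∑' i, nonnegExp E (f i) := by
  rcases eq_or_ne (∑' i, nonnegExp E (f i)) ∞ with htop | htop
  · rw [htop]; exact le_top
  have hpart (n : ℕ) : nonnegExp E (fun y => ∑ i ∈ Finset.range n, f i y) ≤
      ∑' i, nonnegExp E (f i) :=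
    (hE.nonnegExp_sum_le f n).trans (ENNReal.sum_le_tsum _)
  set A : Set Y := {y | ∑' i, f i y = ∞}
  let ind : Y → ℝ≥0∞ := A.indicator 1
  have hind : nonnegExp E ind = 0 := by
    by_contra hne
    obtain ⟨N, hN⟩ := ENNReal.exists_nat_mul_gt hne htop
    have hev : ∀ᶠ n in atTop, ∀ y, N * ind y ≤ ∑ i ∈ Finset.range n, f i y := by
      refine eventually_all.2 fun y => ?_
      by_cases hy : y ∈ A
      · have ht := ENNReal.tendsto_nat_tsum fun i => f i y
        rw [show ∑' i, f i y = ∞ from hy] at ht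
        filter_upwards [ht.eventually (lt_mem_nhds (ENNReal.natCast_lt_top N))] with n hn
        simpa [ind, hy] using hn.le
      · simp [ind, hy]
    obtain ⟨n, hn⟩ := hev.exists
    exact absurd ((hE.nonnegExp_const_mul N ind).symm.le.trans
      ((hE.nonnegExp_mono hn).trans (hpart n))) hN.not_ge
  refine ENNReal.le_of_forall_pos_le_add fun ε hε _ => ?_
  have hev : ∀ᶠ n in atTop, ∀ y,
      ∑' i, f i y ≤ ∞ * ind y + (∑ i ∈ Finset.range n, f i y + ε) := by
    refine eventually_all.2 fun y => ?_
    by_cases hy : y ∈ A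
    · simp [ind, hy]
    · have ht := (ENNReal.tendsto_nat_tsum fun i => f i y).add_const (ε : ℝ≥0∞)
      have hlt : ∑' i, f i y < ∑' i, f i y + ε :=
        ENNReal.lt_add_right hy (by simpa using hε.ne')
      filter_upwards [ht.eventually (lt_mem_nhds hlt)] with n hn
      simpa [ind, hy] using hn.le
  obtain ⟨n, hn⟩ := hev.exists
  calc nonnegExp E (fun y => ∑' i, f i y)
      ≤ nonnegExp E (fun y => ∞ * ind y + (∑ i ∈ Finset.range n, f i y + ε)) :=
        hE.nonnegExp_mono hn
    _ ≤ nonnegExp E (fun y => ∞ * ind y) +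
          (nonnegExp E (fun y => ∑ i ∈ Finset.range n, f i y) + nonnegExp E fun _ => (ε : ℝ≥0∞)) :=
        (hE.nonnegExp_add_le _ _).trans (by gcongr; exact hE.nonnegExp_add_le _ _)
    _ ≤ ∑' i, nonnegExp E (f i) + ε := by
        rw [hE.nonnegExp_const_mul, hind, mul_zero, zero_add,
          hE.nonnegExp_const ENNReal.coe_ne_top]
        gcongr
        exact hpart n

end IsUpperExpectation

/-- A `[0, ∞]`-valued supermartingale. -/
def IsNonnegSupermartingale {X : Type*} (Q : List X → (X → EReal) → EReal)
    (T : List X → ℝ≥0∞) : Prop :=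
  ∀ t, nonnegExp (Q t) (fun x => T (t ++ [x])) ≤ T t

lemma IsNonnegSupermartingale.const_mul {X : Type*} {Q : List X → (X → EReal) → EReal}
    (hQ : ∀ t, IsUpperExpectation (Q t)) {T : List X → ℝ≥0∞} (hT : IsNonnegSupermartingale Q T)
    (c : ℝ≥0∞) : IsNonnegSupermartingale Q fun t => c * T t := fun t => by
  rw [(hQ t).nonnegExp_const_mul]
  exact mul_le_mul_right (hT t) c

/-- A countable family of test supermartingales is dominated, as regards divergence to `∞`, by a
single one. -/
lemma exists_test_of_countable {X : Type*} [Finite X] {Q : List X → (X → EReal) → EReal}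
    (hQ : ∀ t, IsUpperExpectation (Q t)) (S : ℕ → List X → ℝ≥0∞)
    (hS : ∀ i, IsNonnegSupermartingale Q (S i)) (hS1 : ∀ i, S i [] = 1) :
    ∃ T : List X → ℝ≥0∞, IsNonnegSupermartingale Q T ∧ T [] = 1 ∧
      ∀ i (u : ℕ → List X), Tendsto (fun n => S i (u n)) atTop (𝓝 ∞) →
        Tendsto (fun n => T (u n)) atTop (𝓝 ∞) := by
  refine ⟨fun t => ∑' i, 2⁻¹ ^ (i + 1) * S i t, fun t => ?_, ?_, fun i u hu => ?_⟩
  · refine ((hQ t).nonnegExp_tsum_le _).trans (ENNReal.tsum_le_tsum fun i => ?_)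
    exact (hS i).const_mul hQ _ t
  · simp only [hS1, mul_one]
    rw [ENNReal.tsum_geometric_add_one, ENNReal.one_sub_inv_two, inv_inv]
    exact ENNReal.inv_mul_cancel two_ne_zero ENNReal.ofNat_ne_top
  · have hne : (2⁻¹ : ℝ≥0∞) ^ (i + 1) ≠ 0 := pow_ne_zero _ (by simp)
    have h := ENNReal.Tendsto.const_mul (a := 2⁻¹ ^ (i + 1)) hu (Or.inl ENNReal.top_ne_zero)
    rw [ENNReal.mul_top hne] at h
    exact tendsto_nhds_top_mono' h fun n =>
      ENNReal.le_tsum (f := fun i => 2⁻¹ ^ (i + 1) * S i (u n)) i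

open scoped Classical in
/-- Update of the pair (completed upcrossings of `[a, b]`, whether currently in an upcrossing)
upon observing the value `v`. -/
noncomputable def crossStep (a b : ℝ≥0∞) (p : ℕ × Bool) (v : ℝ≥0∞) : ℕ × Bool :=
  if p.2 then (if b ≤ v then (p.1 + 1, false) else p) else (if v ≤ a then (p.1, true) else p)

/-- The upcrossing state of the process `N` after the reversed situation. -/
noncomputable def crossRev {X : Type*} (a b : ℝ≥0∞) (N : List X → ℝ≥0∞) : List X → ℕ × Bool
  | [] => (0, false)
  | x :: r => crossStep a b (crossRev a b N r) (N (r.reverse ++ [x]))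

/-- The upcrossing state of the process `N` in a situation. -/
noncomputable def crossState {X : Type*} (a b : ℝ≥0∞) (N : List X → ℝ≥0∞) (t : List X) :
    ℕ × Bool :=
  crossRev a b N t.reverse

lemma crossState_concat {X : Type*} (a b : ℝ≥0∞) (N : List X → ℝ≥0∞) (t : List X) (x : X) :
    crossState a b N (t ++ [x]) = crossStep a b (crossState a b N t) (N (t ++ [x])) := by
  simp [crossState, crossRev]

/-- Capital of the gambler who pays `a` for a unit of `N` at the start of each upcrossing and
sells it for `a + d` at its end. -/
noncomputable def crossCapital {X : Type*} (a d : ℝ≥0∞) (N : List X → ℝ≥0∞) (t : List X) :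
    ℝ≥0∞ :=
  (crossState a (a + d) N t).1 * d + if (crossState a (a + d) N t).2 then N t else a

lemma isNonnegSupermartingale_crossCapital {X : Type*} {Q : List X → (X → EReal) → EReal}
    (hQ : ∀ t, IsUpperExpectation (Q t)) {N : List X → ℝ≥0∞} (hN : IsNonnegSupermartingale Q N)
    {a d : ℝ≥0∞} (ha : a ≠ ∞) (hd : d ≠ ∞) :
    IsNonnegSupermartingale Q (crossCapital a d N) := fun t => by
  simp only [crossCapital, crossState_concat]
  obtain ⟨k, on⟩ := crossState a (a + d) N t
  have hkd : (k : ℝ≥0∞) * d ≠ ∞ := ENNReal.mul_ne_top (ENNReal.natCast_ne_top k) hd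
  cases on
  · calc _ ≤ nonnegExp (Q t) fun _ => k * d + a := by
          refine (hQ t).nonnegExp_mono fun x => ?_
          by_cases h : N (t ++ [x]) ≤ a
          · simpa [crossStep, h] using add_le_add_right h _
          · simp [crossStep, h]
      _ = _ := by simpa using (hQ t).nonnegExp_const (ENNReal.add_ne_top.2 ⟨hkd, ha⟩)
  · calc _ ≤ nonnegExp (Q t) fun x => k * d + N (t ++ [x]) := by
          refine (hQ t).nonnegExp_mono fun x => ?_
          by_cases h : a + d ≤ N (t ++ [x])
          · have : (k + 1) * d + a = k * d + (a + d) := by ring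
            simpa [crossStep, h, this] using add_le_add_right h _
          · simp [crossStep, h]
      _ ≤ k * d + N t := by
          refine ((hQ t).nonnegExp_add_le _ _).trans ?_
          rw [(hQ t).nonnegExp_const hkd]
          gcongr
          exact hN t
      _ = _ := by simp

lemma exists_le_crossStep_count {a b : ℝ≥0∞} {p : ℕ → ℕ × Bool} {u : ℕ → ℝ≥0∞}
    (hp : ∀ n, p (n + 1) = crossStep a b (p n) (u (n + 1)))
    (hlo : ∃ᶠ n in atTop, u n ≤ a) (hhi : ∃ᶠ n in atTop, b ≤ u n) (K : ℕ) :
    ∀ᶠ n in atTop, K ≤ (p n).1 := by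
  have hmono : Monotone fun n => (p n).1 := monotone_nat_of_le_succ fun n => by
    rw [hp, crossStep]; split_ifs <;> simp
  suffices ∃ n, K ≤ (p n).1 by
    obtain ⟨n, hn⟩ := this
    exact eventually_atTop.2 ⟨n, fun m hm => hn.trans (hmono hm)⟩
  have hon (n : ℕ) : ∃ m ≥ n, (p m).2 = true := by
    by_contra! hoff
    obtain ⟨m, hm, hum⟩ := frequently_atTop.1 hlo (n + 1)
    obtain ⟨m, rfl⟩ : ∃ j, m = j + 1 := ⟨m - 1, by omega⟩
    have h1 := hoff m (by omega)
    have h2 := hoff (m + 1) (by omega)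
    simp [hp, crossStep, h1, hum] at h2
  have hinc (n : ℕ) (hn : (p n).2 = true) : ∃ m ≥ n, (p n).1 < (p m).1 := by
    by_contra! hle
    have hconst (m : ℕ) (hm : n ≤ m) : p m = p n := by
      induction m, hm using Nat.le_induction with
      | base => rfl
      | succ m hm ih =>
        have := hle (m + 1) (by omega)
        rw [hp, ih, crossStep] at this ⊢
        split_ifs at this ⊢ <;> simp_all
    obtain ⟨m, hm, hum⟩ := frequently_atTop.1 hhi (n + 1)
    obtain ⟨m, rfl⟩ : ∃ j, m = j + 1 := ⟨m - 1, by omega⟩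
    have h := hle (m + 1) (by omega)
    simp [hp, crossStep, hconst m (by omega), hn, hum] at h
  induction K with
  | zero => exact ⟨0, Nat.zero_le _⟩
  | succ K ih =>
    obtain ⟨n, hn⟩ := ih
    obtain ⟨m, hm, hmon⟩ := hon n
    obtain ⟨j, -, hj⟩ := hinc m hmon
    have : (p n).1 ≤ (p m).1 := hmono hm
    exact ⟨j, by omega⟩

lemma seg_succ {X : Type*} (ω : ℕ → X) (n : ℕ) : seg ω (n + 1) = seg ω n ++ [ω n] := by
  simp only [seg, List.ofFn_succ', List.concat_eq_append, Fin.val_castSucc, Fin.val_last]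

lemma seg_add {X : Type*} (ω : ℕ → X) (m n : ℕ) :
    seg ω (m + n) = seg ω m ++ seg (fun i => ω (m + i)) n := by
  induction n with
  | zero => simp [seg]
  | succ n ih => rw [← add_assoc, seg_succ, seg_succ, ih, List.append_assoc]

lemma exists_test_upcrossing {X : Type*} {Q : List X → (X → EReal) → EReal}
    (hQ : ∀ t, IsUpperExpectation (Q t)) {N : List X → ℝ≥0∞} (hN : IsNonnegSupermartingale Q N)
    (a b : ℝ≥0∞) :
    ∃ T : List X → ℝ≥0∞, IsNonnegSupermartingale Q T ∧ T [] = 1 ∧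
      ∀ ω : ℕ → X, a < b → (∃ᶠ n in atTop, N (seg ω n) < a) → (∃ᶠ n in atTop, b < N (seg ω n)) →
        Tendsto (fun n => T (seg ω n)) atTop (𝓝 ∞) := by
  by_cases hab : a ≠ 0 ∧ a < b ∧ b ≠ ∞
  · obtain ⟨ha, hab, hb⟩ := hab
    have hatop : a ≠ ∞ := hab.ne_top
    have hd : b - a ≠ ∞ := ENNReal.sub_ne_top hb
    have hd0 : b - a ≠ 0 := (tsub_pos_of_lt hab).ne'
    refine ⟨fun t => a⁻¹ * crossCapital a (b - a) N t,
      (isNonnegSupermartingale_crossCapital hQ hN hatop hd).const_mul hQ _, ?_,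
      fun ω _ hlo hhi => ?_⟩
    · simp [crossCapital, crossState, crossRev, ENNReal.inv_mul_cancel ha hatop]
    · have hcount := exists_le_crossStep_count
        (p := fun n => crossState a (a + (b - a)) N (seg ω n)) (u := fun n => N (seg ω n))
        (fun n => by simp only [seg_succ, crossState_concat]) (hlo.mono fun n hn => hn.le)
        (hhi.mono fun n hn => (add_tsub_cancel_of_le hab.le).trans_le hn.le)
      have hk : Tendsto (fun n => ((crossState a (a + (b - a)) N (seg ω n)).1 : ℝ≥0∞)) atTop
          (𝓝 ∞) :=
        ENNReal.tendsto_nat_nhds_top.comp (tendsto_atTop.2 hcount)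
      have hkd := ENNReal.Tendsto.mul_const (b := b - a) hk (Or.inl ENNReal.top_ne_zero)
      rw [ENNReal.top_mul hd0] at hkd
      have hcap : Tendsto (fun n => crossCapital a (b - a) N (seg ω n)) atTop (𝓝 ∞) :=
        tendsto_nhds_top_mono' hkd fun n => le_self_add
      have h := ENNReal.Tendsto.const_mul (a := a⁻¹) hcap (Or.inl ENNReal.top_ne_zero)
      rwa [ENNReal.mul_top (ENNReal.inv_ne_zero.2 hatop)] at h
  · refine ⟨fun _ => 1, fun t => ((hQ t).nonnegExp_const ENNReal.one_ne_top).le, rfl,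
      fun ω hlt hlo hhi => absurd ⟨?_, hlt, ?_⟩ hab⟩
    · obtain ⟨n, hn⟩ := hlo.exists
      exact hn.ne_bot
    · obtain ⟨n, hn⟩ := hhi.exists
      exact hn.ne_top

/-- Doob's convergence theorem for `[0, ∞]`-valued supermartingales, from the root. -/
lemma exists_test_of_not_convergent {X : Type*} [Finite X] {Q : List X → (X → EReal) → EReal}
    (hQ : ∀ t, IsUpperExpectation (Q t)) {N : List X → ℝ≥0∞} (hN : IsNonnegSupermartingale Q N)
    (h0 : N [] ≠ 0) (htop : N [] ≠ ∞) :
    ∃ T : List X → ℝ≥0∞, IsNonnegSupermartingale Q T ∧ T [] = 1 ∧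
      ∀ ω : ℕ → X, (¬ ∃ c : ℝ≥0∞, c ≠ ∞ ∧ Tendsto (fun n => N (seg ω n)) atTop (𝓝 c)) →
        Tendsto (fun n => T (seg ω n)) atTop (𝓝 ∞) := by
  let q := TopologicalSpace.denseSeq ℝ≥0∞
  choose S hS hS1 hSup using fun i j : ℕ => exists_test_upcrossing hQ hN (q i) (q j)
  let F : ℕ → List X → ℝ≥0∞
    | 0 => fun t => (N [])⁻¹ * N t
    | n + 1 => S n.unpair.1 n.unpair.2
  obtain ⟨T, hT, hT1, hdiv⟩ := exists_test_of_countable hQ F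
    (fun i => by
      cases i with
      | zero => exact hN.const_mul hQ _
      | succ n => exact hS _ _)
    (fun i => by
      cases i with
      | zero => exact ENNReal.inv_mul_cancel h0 htop
      | succ n => exact hS1 _ _)
  refine ⟨T, hT, hT1, fun ω hω => ?_⟩
  by_cases hconv : ∃ c, Tendsto (fun n => N (seg ω n)) atTop (𝓝 c)
  · obtain ⟨c, hc⟩ := hconv
    obtain rfl : c = ∞ := by
      by_contra hne
      exact hω ⟨c, hne, hc⟩
    refine hdiv 0 _ ?_
    have h := ENNReal.Tendsto.const_mul (a := (N [])⁻¹) hc (Or.inl ENNReal.top_ne_zero)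
    rwa [ENNReal.mul_top (ENNReal.inv_ne_zero.2 htop)] at h
  · have hup : ¬ ∀ a ∈ Set.range q, ∀ b ∈ Set.range q, a < b →
        ¬((∃ᶠ n in atTop, N (seg ω n) < a) ∧ ∃ᶠ n in atTop, b < N (seg ω n)) :=
      fun H => hconv (tendsto_of_no_upcrossings (TopologicalSpace.denseRange_denseSeq ℝ≥0∞) H)
    push Not at hup
    obtain ⟨_, ⟨i, rfl⟩, _, ⟨j, rfl⟩, hij, hlo, hhi⟩ := hup
    refine hdiv (Nat.pair i j + 1) _ ?_
    simpa [F] using hSup i j ω hij hlo hhi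

lemma isNonnegSupermartingale_shift {X : Type*} {Q : List X → (X → EReal) → EReal}
    (hQ : ∀ t, IsUpperExpectation (Q t)) {M : List X → EReal} (hM : IsSupermartingale Q M)
    {C : ℝ} (hC : ∀ t, 0 ≤ M t + C) (s : List X) :
    IsNonnegSupermartingale (fun t => Q (s ++ t)) fun t => (M (s ++ t) + C).toENNReal := by
  obtain ⟨⟨B, hB⟩, hM⟩ := hM
  intro t
  rw [← EReal.coe_ennreal_le_coe_ennreal_iff, (hQ _).coe_nonnegExp]
  simp only [EReal.coe_toENNReal (hC _)]
  refine ((hQ _).subadd (fun x => M (s ++ (t ++ [x]))) _ ⟨B, fun _ => hB _⟩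
    ⟨C, fun _ => le_rfl⟩).trans ?_
  rw [(hQ _).const]
  gcongr
  simpa using hM (s ++ t)

open scoped Classical in
/-- A non-negative supermartingale of the subtree rooted at `s` extends to the whole tree. -/
lemma exists_isSupermartingale_extend {X : Type*} {Q : List X → (X → EReal) → EReal}
    (hQ : ∀ t, IsUpperExpectation (Q t)) (s : List X) {T : List X → ℝ≥0∞}
    (hT : IsNonnegSupermartingale (fun t => Q (s ++ t)) T) :
    ∃ U : List X → EReal, IsSupermartingale Q U ∧ (∀ t, 0 ≤ U t) ∧
      ∀ t, U (s ++ t) = (T t : EReal) := by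
  let U : List X → EReal := fun t => if s <+: t then (T (t.drop s.length) : EReal) else ⊤
  have hnonneg (t : List X) : 0 ≤ U t := by
    simp only [U]
    split_ifs
    · exact EReal.coe_ennreal_nonneg _
    · exact le_top
  have hext (t : List X) : U (s ++ t) = (T t : EReal) := by simp [U]
  refine ⟨U, ⟨⟨0, by simpa using hnonneg⟩, fun t => ?_⟩, hnonneg, hext⟩
  by_cases ht : s <+: t
  · obtain ⟨t, rfl⟩ := ht
    simp only [List.append_assoc, hext]
    rw [← (hQ _).coe_nonnegExp]
    exact_mod_cast hT t
  · simp [U, ht]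

/-- Theorem 2 (Doob's convergence theorem): if a supermartingale is real in some
situation `s`, it converges to a real number strictly almost surely within
`Γ(s)`: some `s`-test supermartingale converges to `+∞` on every path through
`s` on which the supermartingale does not converge to a real number. -/
theorem stmt15 {X : Type*} [Fintype X] [Nonempty X]
    (Q : List X → (X → EReal) → EReal) (hQ : ∀ s, IsUpperExpectation (Q s))
    (M : List X → EReal) (hM : IsSupermartingale Q M) (s : List X)
    (hreal : ∃ r : ℝ, M s = (r : EReal)) :
    ∃ T : List X → EReal, IsSupermartingale Q T ∧ (∀ t, 0 ≤ T t) ∧ T s = 1 ∧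
      ∀ ω ∈ cyl s,
        (¬ ∃ r : ℝ, Tendsto (fun n => M (seg ω n)) atTop (𝓝 ((r : ℝ) : EReal))) →
        Tendsto (fun n => T (seg ω n)) atTop (𝓝 (⊤ : EReal)) := by
  obtain ⟨r, hr⟩ := hreal
  obtain ⟨B, hB⟩ := hM.1
  set C : ℝ := 1 - B with hCdef
  have hone (t : List X) : 1 ≤ M t + C := by
    calc (1 : EReal) = (B : EReal) + C := by
          rw [← EReal.coe_add, hCdef, add_sub_cancel, EReal.coe_one]
      _ ≤ M t + C := by gcongr; exact hB t
  have hC (t : List X) : 0 ≤ M t + C := zero_le_one.trans (hone t)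
  obtain ⟨T, hT, hT1, hdiv⟩ := exists_test_of_not_convergent (fun t => hQ (s ++ t))
    (isNonnegSupermartingale_shift hQ hM hC s)
    (by
      rw [List.append_nil, Ne, EReal.toENNReal_eq_zero_iff, not_le]
      exact zero_lt_one.trans_le (hone s))
    (by
      rw [List.append_nil, hr, ← EReal.coe_add, Ne, EReal.toENNReal_eq_top_iff]
      exact EReal.coe_ne_top _)
  obtain ⟨U, hU, hnonneg, hext⟩ := exists_isSupermartingale_extend hQ s hT
  refine ⟨U, hU, hnonneg, by simpa [hT1] using hext [], fun ω hω hconv => ?_⟩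
  have hseg (n : ℕ) :
      seg ω (n + s.length) = s ++ seg (fun i => ω (s.length + i)) n := by
    rw [add_comm, seg_add, show seg ω s.length = s from hω]
  rw [← tendsto_add_atTop_iff_nat s.length]
  simp only [hseg, hext]
  rw [← EReal.coe_ennreal_top]
  refine (continuous_coe_ennreal_ereal.tendsto _).comp (hdiv _ ?_)
  rintro ⟨c, hc, hlim⟩
  refine hconv ⟨c.toReal + -C, ?_⟩
  rw [← tendsto_add_atTop_iff_nat s.length]
  have hlim' := (continuous_coe_ennreal_ereal.tendsto c).comp hlim
  have hadd := (EReal.continuousAt_add (p := ((c : EReal), ((-C : ℝ) : EReal)))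
    (Or.inr (EReal.coe_ne_bot _)) (Or.inr (EReal.coe_ne_top _))).tendsto.comp
      (hlim'.prodMk_nhds tendsto_const_nhds)
  convert hadd using 2
  · simp only [Function.comp_apply, hseg]
    rw [EReal.coe_toENNReal (hC _), EReal.coe_neg, add_assoc, ← sub_eq_add_neg,
      EReal.sub_self (EReal.coe_ne_top _) (EReal.coe_ne_bot _), add_zero]
  · rw [EReal.coe_add, EReal.coe_ennreal_toReal hc]
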